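/- For all ξ₁, η₁, ξ₂, η₂ ∈ C_c²((0,∞)): ∫₀^∞ ∫_ℝ (−(2πi)⁻¹ · a · (∂/∂b)(ξ₁ *₊ η₁)(b,a)) · conj((ξ₂ *₊ η₂)(b,a)) db a⁻² da = (∫₀^∞ ξ₁(t) conj(ξ₂(t)) t⁻¹ dt) · (∫₀^∞ η₂(t) conj(η₁(t)) t⁻¹ dt). In particular the left-hand integrand is integrable, and choosing ξ₁ = η₁ = ξ₂ = η₂ its value is strictly positive when ξ₁ ≠ 0, so the bilinear form D♭(f,g) = ∫_G (−(2πi)⁻¹ a ∂_b f) g dμ is not identically zero on coefficient functions. -/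

import Mathlib

open MeasureTheory Set

/-- Coefficient function of the representation `π₊` of the real `ax+b` group:
`(ξ *₊ η)(b,a) = ∫₀^∞ e^{-2πibt} ξ(at) conj(η(t)) t⁻¹ dt`. -/
noncomputable def coeffP (ξ η : ℝ → ℂ) (b a : ℝ) : ℂ :=
  ∫ t in Ioi (0 : ℝ),
    Complex.exp (-(2 * Real.pi * b * t : ℝ) * Complex.I) * ξ (a * t)
      * starRingEnd ℂ (η t) * (t : ℂ)⁻¹

/-- Coefficient function of the representation `π₋` of the real `ax+b` group:
`(ξ *₋ η)(b,a) = ∫₀^∞ e^{2πibt} ξ(at) conj(η(t)) t⁻¹ dt`. -/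
noncomputable def coeffM (ξ η : ℝ → ℂ) (b a : ℝ) : ℂ :=
  ∫ t in Ioi (0 : ℝ),
    Complex.exp ((2 * Real.pi * b * t : ℝ) * Complex.I) * ξ (a * t)
      * starRingEnd ℂ (η t) * (t : ℂ)⁻¹

/-- `C_c²((0,∞))`: twice continuously differentiable complex-valued functions on `ℝ`
with compact support contained in `(0,∞)`. -/
def CcTwo (f : ℝ → ℂ) : Prop :=
  ContDiff ℝ 2 f ∧ HasCompactSupport f ∧ tsupport f ⊆ Ioi (0 : ℝ)

/-- Left Haar measure `a⁻² db da` of the `ax+b` group, modelled on `ℝ × (0,∞)`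
(first coordinate `b`, second coordinate `a`). -/
noncomputable def muG : Measure (ℝ × ℝ) :=
  (((volume : Measure ℝ).prod ((volume : Measure ℝ).restrict (Ioi (0 : ℝ)))).withDensity
    fun p => ENNReal.ofReal ((p.2 ^ 2)⁻¹))

open FourierTransform ComplexConjugate

theorem CcTwo.eq_zero_of_nonpos {f : ℝ → ℂ} (hf : CcTwo f) {t : ℝ} (ht : t ≤ 0) : f t = 0 := by
  by_contra h
  exact absurd (hf.2.2 (subset_tsupport f h)) (by simpa using ht)

theorem CcTwo.continuous {f : ℝ → ℂ} (hf : CcTwo f) : Continuous f := hf.1.continuous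

theorem CcTwo.integrable {f : ℝ → ℂ} (hf : CcTwo f) : Integrable f :=
  hf.continuous.integrable_of_hasCompactSupport hf.2.1

theorem CcTwo.conj {f : ℝ → ℂ} (hf : CcTwo f) : CcTwo fun t => conj (f t) := by
  have hsub : tsupport (fun t => conj (f t)) ⊆ tsupport f :=
    closure_mono fun t ht h => ht (by simp [h])
  exact ⟨Complex.conjCLE.contDiff.comp hf.1, hf.2.1.comp_left (g := conj) (by simp),
    hsub.trans hf.2.2⟩

/-- Multiplication by a function that is `C²` on `(0,∞)` preserves `C_c²((0,∞))`. -/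
theorem CcTwo.mul_of_contDiffAt {f g : ℝ → ℂ} (hf : CcTwo f)
    (hg : ∀ t > 0, ContDiffAt ℝ 2 g t) : CcTwo fun t => f t * g t := by
  have hsub : tsupport (fun t => f t * g t) ⊆ tsupport f :=
    closure_mono fun t ht h => ht (by simp [h])
  refine ⟨contDiff_iff_contDiffAt.2 fun t => ?_, hf.2.1.mul_right, hsub.trans hf.2.2⟩
  by_cases ht : t ∈ tsupport f
  · exact hf.1.contDiffAt.mul (hg t (hf.2.2 ht))
  · exact contDiffAt_const.congr_of_eventuallyEq
      (notMem_tsupport_iff_eventuallyEq.1 fun h => ht (hsub h))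

theorem CcTwo.mul_inv {f : ℝ → ℂ} (hf : CcTwo f) : CcTwo fun t => f t * (t : ℂ)⁻¹ :=
  hf.mul_of_contDiffAt fun t ht =>
    (Complex.ofRealCLM.contDiff.contDiffAt (x := t)).inv (by simpa using ht.ne')

theorem CcTwo.exists_tsupport_subset_Icc {f : ℝ → ℂ} (hf : CcTwo f) :
    ∃ m M : ℝ, 0 < m ∧ ∀ t, f t ≠ 0 → m ≤ t ∧ t ≤ M := by
  rcases (tsupport f).eq_empty_or_nonempty with h | h
  · exact ⟨1, 1, one_pos, fun t ht => absurd (subset_tsupport f ht) (by simp [h])⟩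
  · obtain ⟨m, hm, hm'⟩ := hf.2.1.isCompact.exists_isLeast h
    obtain ⟨M, hM, hM'⟩ := hf.2.1.isCompact.exists_isGreatest h
    exact ⟨m, M, hf.2.2 hm, fun t ht => ⟨hm' (subset_tsupport f ht), hM' (subset_tsupport f ht)⟩⟩

/-- The dilation parameters `a` for which `ξ (a ·)` and `w` have overlapping supports stay in a
compact subset of `(0,∞)`. -/
theorem CcTwo.exists_dilation_mul_eq_zero {ξ w : ℝ → ℂ} (hξ : CcTwo ξ) (hw : CcTwo w) :
    ∃ c d : ℝ, 0 < c ∧ ∀ a, 0 < a → a ∉ Icc c d → ∀ t, ξ (a * t) * w t = 0 := by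
  obtain ⟨m, M, hm, hM⟩ := hξ.exists_tsupport_subset_Icc
  obtain ⟨m', M', hm', hM'⟩ := hw.exists_tsupport_subset_Icc
  refine ⟨m / max M' 1, M / m', by positivity, fun a ha hna t => ?_⟩
  by_contra h
  obtain ⟨h1, h2⟩ := hM _ (left_ne_zero_of_mul h)
  obtain ⟨h3, h4⟩ := hM' _ (right_ne_zero_of_mul h)
  refine hna ⟨?_, ?_⟩
  · rw [div_le_iff₀ (by positivity)]
    exact h1.trans (by gcongr; exact h4.trans (le_max_left _ _))
  · rw [le_div_iff₀ hm']
    exact le_trans (by gcongr) h2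

theorem integrable_dilation_mul {ξ w : ℝ → ℂ} (hξ : Continuous ξ) (hw : Continuous w)
    (hws : HasCompactSupport w) (a : ℝ) : Integrable fun t => ξ (a * t) * w t :=
  Continuous.integrable_of_hasCompactSupport (by fun_prop) hws.mul_left

theorem norm_fourier_dilation_mul_le {ξ w : ℝ → ℂ} {C : ℝ} (hC : ∀ t, ‖ξ t‖ ≤ C)
    (hw : Integrable w) (a b : ℝ) :
    ‖𝓕 (fun t => ξ (a * t) * w t) b‖ ≤ C * ∫ t, ‖w t‖ := by
  rw [Real.fourier_real_eq, ← integral_const_mul]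
  refine norm_integral_le_of_norm_le (hw.norm.const_mul C) (.of_forall fun t => ?_)
  rw [Circle.norm_smul, norm_mul]
  gcongr
  exact hC _

/-- Integration by parts for the Fourier transform of `t ↦ ξ (a t) w t`. -/
theorem mul_fourier_dilation_mul {ξ w : ℝ → ℂ} (hξ : ContDiff ℝ 1 ξ) (hw : ContDiff ℝ 1 w)
    (hws : HasCompactSupport w) (a b : ℝ) :
    (2 * Real.pi * Complex.I * b) * 𝓕 (fun t => ξ (a * t) * w t) b =
      a * 𝓕 (fun t => deriv ξ (a * t) * w t) b + 𝓕 (fun t => ξ (a * t) * deriv w t) b := by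
  have hξ' : Continuous (deriv ξ) := hξ.continuous_deriv le_rfl
  have hw' : Continuous (deriv w) := hw.continuous_deriv le_rfl
  have i1 := integrable_dilation_mul hξ' hw.continuous hws a
  have i2 := integrable_dilation_mul hξ.continuous hw' hws.deriv a
  have hd : ∀ t, HasDerivAt (fun t => ξ (a * t) * w t)
      ((a : ℂ) * (deriv ξ (a * t) * w t) + ξ (a * t) * deriv w t) t := fun t => by
    have h1 := ((hξ.differentiable one_ne_zero (a * t)).hasDerivAt.scomp t
      ((hasDerivAt_id t).const_mul a)).mul (hw.differentiable one_ne_zero t).hasDerivAt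
    refine h1.congr_deriv ?_
    simp only [mul_one, Complex.real_smul, Function.comp_apply]
    ring
  have hde : deriv (fun t => ξ (a * t) * w t) =
      fun t => (a : ℂ) * (deriv ξ (a * t) * w t) + ξ (a * t) * deriv w t :=
    funext fun t => (hd t).deriv
  have hint := (i1.const_mul (a : ℂ)).add i2
  have key := congrFun (Real.fourier_deriv (integrable_dilation_mul hξ.continuous hw.continuous hws a)
    (fun t => (hd t).differentiableAt) (by rw [hde]; exact hint)) b
  rw [smul_eq_mul, hde] at key
  rw [← key]
  simp only [Real.fourier_real_eq]
  rw [← integral_const_mul, ← integral_add]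
  · congr with t
    simp only [Circle.smul_def, smul_eq_mul]
    ring
  · exact ((Real.fourierIntegral_convergent_iff b).2 i1 |>.const_mul (a : ℂ)).congr
      (.of_forall fun t => by simp [mul_comm b])
  · exact ((Real.fourierIntegral_convergent_iff b).2 i2).congr
      (.of_forall fun t => by simp [mul_comm b])

theorem exists_norm_fourier_dilation_mul_le {ξ w : ℝ → ℂ} (hξ : Continuous ξ)
    (hξs : HasCompactSupport ξ) (hw : Continuous w) (hws : HasCompactSupport w) :
    ∃ C : ℝ, ∀ a b, ‖𝓕 (fun t => ξ (a * t) * w t) b‖ ≤ C := by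
  obtain ⟨C, hC⟩ := hξs.exists_bound_of_continuous hξ
  exact ⟨_, norm_fourier_dilation_mul_le hC (hw.integrable_of_hasCompactSupport hws)⟩

/-- Quadratic decay of the Fourier transform of `t ↦ ξ (a t) w t`, locally uniformly in the
dilation parameter. -/
theorem exists_norm_fourier_dilation_mul_le_inv {ξ w : ℝ → ℂ} (hξ : ContDiff ℝ 2 ξ)
    (hξs : HasCompactSupport ξ) (hw : ContDiff ℝ 2 w) (hws : HasCompactSupport w) (d : ℝ) :
    ∃ C : ℝ, 0 ≤ C ∧ ∀ a b, 0 ≤ a → a ≤ d →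
      ‖𝓕 (fun t => ξ (a * t) * w t) b‖ ≤ C * (1 + b ^ 2)⁻¹ := by
  have hξ1 : ContDiff ℝ 1 (deriv ξ) := ((contDiff_succ_iff_deriv (n := 1)).1 hξ).2.2
  have hw1 : ContDiff ℝ 1 (deriv w) := ((contDiff_succ_iff_deriv (n := 1)).1 hw).2.2
  have hξ2 := hξ1.continuous_deriv le_rfl
  have hw2 := hw1.continuous_deriv le_rfl
  have hξ0 : ContDiff ℝ 1 ξ := hξ.of_le one_le_two
  have hw0 : ContDiff ℝ 1 w := hw.of_le one_le_two
  obtain ⟨C, hC⟩ := exists_norm_fourier_dilation_mul_le hξ.continuous hξs hw.continuous hws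
  obtain ⟨C₁, hC₁⟩ := exists_norm_fourier_dilation_mul_le hξ2 hξs.deriv.deriv hw.continuous hws
  obtain ⟨C₂, hC₂⟩ :=
    exists_norm_fourier_dilation_mul_le hξ1.continuous hξs.deriv hw1.continuous hws.deriv
  obtain ⟨C₃, hC₃⟩ := exists_norm_fourier_dilation_mul_le hξ.continuous hξs hw2 hws.deriv.deriv
  have p0 := (norm_nonneg _).trans (hC 0 0)
  have p1 := (norm_nonneg _).trans (hC₁ 0 0)
  have p2 := (norm_nonneg _).trans (hC₂ 0 0)
  have p3 := (norm_nonneg _).trans (hC₃ 0 0)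
  refine ⟨C + (d ^ 2 * C₁ + 2 * |d| * C₂ + C₃), by positivity, fun a b ha had => ?_⟩
  set F := 𝓕 (fun t => ξ (a * t) * w t) b
  have e : (2 * Real.pi * Complex.I * b) ^ 2 * F =
      a ^ 2 * 𝓕 (fun t => deriv (deriv ξ) (a * t) * w t) b
        + 2 * a * 𝓕 (fun t => deriv ξ (a * t) * deriv w t) b
        + 𝓕 (fun t => ξ (a * t) * deriv (deriv w) t) b := by
    have e1 := mul_fourier_dilation_mul hξ0 hw0 hws a b
    have e2 := mul_fourier_dilation_mul hξ1 hw0 hws a b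
    have e3 := mul_fourier_dilation_mul hξ0 hw1 hws.deriv a b
    linear_combination (2 * Real.pi * Complex.I * b) * e1 + a * e2 + e3
  have hn : (2 * Real.pi) ^ 2 * b ^ 2 * ‖F‖ ≤ d ^ 2 * C₁ + 2 * |d| * C₂ + C₃ := by
    have h := congrArg norm e
    have hl : ‖(2 * Real.pi * Complex.I * b) ^ 2 * F‖ = (2 * Real.pi) ^ 2 * b ^ 2 * ‖F‖ := by
      simp [mul_pow]
    rw [← hl, h]
    refine (norm_add₃_le).trans ?_
    simp only [norm_mul, norm_pow, Complex.norm_real, Complex.norm_ofNat, Real.norm_eq_abs,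
      abs_of_nonneg ha]
    have had' : a ≤ |d| := had.trans (le_abs_self d)
    gcongr
    exacts [hC₁ a b, hC₂ a b, hC₃ a b]
  have hpi : (1 : ℝ) ≤ (2 * Real.pi) ^ 2 := by nlinarith [Real.pi_gt_three]
  rw [← div_eq_mul_inv, le_div_iff₀ (by positivity)]
  have := mul_le_mul_of_nonneg_right hpi (by positivity : 0 ≤ b ^ 2 * ‖F‖)
  nlinarith [hC a b]

theorem coeffP_eq_fourier {ξ η : ℝ → ℂ} (hη : CcTwo η) (b a : ℝ) :
    coeffP ξ η b a = 𝓕 (fun t => ξ (a * t) * (conj (η t) * (t : ℂ)⁻¹)) b := by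
  rw [coeffP, Real.fourier_real_eq_integral_exp_smul,
    setIntegral_eq_integral_of_forall_compl_eq_zero]
  · congr with t
    rw [smul_eq_mul]
    push_cast
    ring_nf
  · intro t ht
    simp [hη.eq_zero_of_nonpos (by simpa using ht)]

theorem mul_deriv_coeffP {ξ η : ℝ → ℂ} (hξ : CcTwo ξ) (hη : CcTwo η) (b a : ℝ) :
    -(2 * (Real.pi : ℂ) * Complex.I)⁻¹ * (a : ℂ) * deriv (fun b : ℝ => coeffP ξ η b a) b =
      a * 𝓕 (fun t => ξ (a * t) * conj (η t)) b := by
  have hv := hη.conj.mul_inv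
  have hi := integrable_dilation_mul hξ.continuous hv.continuous hv.2.1 a
  have hmul : ∀ t : ℝ, (t : ℂ) * (conj (η t) * (t : ℂ)⁻¹) = conj (η t) := fun t => by
    rcases eq_or_ne t 0 with rfl | ht
    · simp [hη.eq_zero_of_nonpos le_rfl]
    · have : (t : ℂ) ≠ 0 := by simpa using ht
      field_simp
  have hi' : Integrable fun t : ℝ => t • (ξ (a * t) * (conj (η t) * (t : ℂ)⁻¹)) :=
    (integrable_dilation_mul hξ.continuous hη.conj.continuous hη.conj.2.1 a).congr
      (.of_forall fun t => by simp only [Complex.real_smul]; rw [mul_left_comm, hmul])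
  have hc : (fun b : ℝ => coeffP ξ η b a) =
      𝓕 (fun t => ξ (a * t) * (conj (η t) * (t : ℂ)⁻¹)) :=
    funext fun b => coeffP_eq_fourier hη b a
  have hpi : (2 * Real.pi * Complex.I : ℂ) ≠ 0 := Complex.two_pi_I_ne_zero
  rw [hc, (Real.hasDerivAt_fourier hi hi' b).deriv, mul_right_comm, mul_comm _ (a : ℂ)]
  congr 1
  rw [Real.fourier_real_eq, Real.fourier_real_eq, ← integral_const_mul]
  congr with t
  simp only [Circle.smul_def, smul_eq_mul]
  rw [← hmul t]
  field_simp

theorem stronglyMeasurable_fourier_dilation_mul {ξ w : ℝ → ℂ} (hξ : Continuous ξ) (hw : Continuous w) :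
    StronglyMeasurable fun p : ℝ × ℝ => 𝓕 (fun t => ξ (p.2 * t) * w t) p.1 := by
  simp only [Real.fourier_real_eq_integral_exp_smul]
  refine StronglyMeasurable.integral_prod_right
    (f := fun (p : ℝ × ℝ) (t : ℝ) =>
      Complex.exp (↑(-2 * Real.pi * t * p.1) * Complex.I) • (ξ (p.2 * t) * w t)) ?_
  exact Continuous.stronglyMeasurable (by unfold Function.uncurry; fun_prop)

/-- Parseval's identity for integrable functions, one with integrable Fourier transform. -/
theorem integral_fourier_mul_conj_fourier {f g : ℝ → ℂ} (hfc : Continuous f) (hf : Integrable f)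
    (hf' : Integrable (𝓕 f)) (hg : Integrable g) :
    ∫ b, 𝓕 f b * conj (𝓕 g b) = ∫ t, f t * conj (g t) := by
  have h := VectorFourier.integral_sesq_fourierIntegral_eq_neg_flip (μ := volume) (ν := volume)
    (L := innerₗ ℝ) (innerSL ℂ : ℂ →L⋆[ℂ] ℂ →L[ℂ] ℂ) Real.continuous_fourierChar continuous_inner
    hg hf'
  rw [flip_innerₗ] at h
  have h2 := hfc.fourierInv_fourier_eq hf hf'
  simp only [innerSL_apply_apply] at h
  exact h.trans (by
    change ∫ t, inner ℂ (g t) (𝓕⁻ (𝓕 f) t) = _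
    rw [h2]; rfl)

theorem integral_dilation_mul_inv (G : ℝ → ℂ) {t : ℝ} (ht : 0 < t) :
    ∫ a in Ioi (0 : ℝ), G (a * t) * (a : ℂ)⁻¹ = ∫ a in Ioi (0 : ℝ), G a * (a : ℂ)⁻¹ := by
  have h := integral_comp_mul_left_Ioi' (fun a : ℝ => G a * (a : ℂ)⁻¹) 0 ht
  rw [mul_zero] at h
  rw [← h, ← integral_smul]
  congr with a
  have : (t : ℂ) ≠ 0 := by simpa using ht.ne'
  simp only [Complex.real_smul, Complex.ofReal_mul]
  rw [mul_comm a t]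
  field_simp

/-- Integrating out the dilation parameter against the Haar
measure `a⁻¹ da` of `(0,∞)` decouples the two factors. -/
theorem integral_integral_dilation_mul {G q : ℝ → ℂ} (hG : CcTwo G) (hq : CcTwo q) :
    ∫ a in Ioi (0 : ℝ), (a : ℂ)⁻¹ * ∫ t, G (a * t) * q t =
      (∫ a in Ioi (0 : ℝ), G a * (a : ℂ)⁻¹) * ∫ t, q t := by
  obtain ⟨c, d, hc, hcd⟩ := hG.exists_dilation_mul_eq_zero hq
  obtain ⟨C, hC⟩ := hG.2.1.exists_bound_of_continuous hG.continuous
  have hC0 : 0 ≤ C := (norm_nonneg _).trans (hC 0)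
  have hint : Integrable (Function.uncurry fun (a t : ℝ) => (a : ℂ)⁻¹ * (G (a * t) * q t))
      ((volume.restrict (Ioi 0)).prod volume) := by
    have hb : Integrable (fun a : ℝ => (Icc c d).indicator (fun _ => c⁻¹ * C) a)
        (volume.restrict (Ioi 0)) :=
      ((integrable_indicator_iff measurableSet_Icc).2
        (integrableOn_const (by simp))).restrict
    refine (hb.mul_prod hq.integrable.norm).mono' ?_ ?_
    · refine Measurable.aestronglyMeasurable ?_
      have := hG.continuous.measurable
      have := hq.continuous.measurable
      unfold Function.uncurry
      fun_prop
    · have : ∀ᵐ p ∂((volume.restrict (Ioi (0 : ℝ))).prod (volume : Measure ℝ)), p.1 ∈ Ioi (0 : ℝ) :=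
        Measure.quasiMeasurePreserving_fst.ae (ae_restrict_mem measurableSet_Ioi)
      filter_upwards [this] with p hp
      by_cases hpm : p.1 ∈ Icc c d
      · rw [Function.uncurry, indicator_of_mem hpm, norm_mul, norm_mul, norm_inv,
          Complex.norm_real, Real.norm_of_nonneg (le_of_lt hp), ← mul_assoc]
        gcongr
        exacts [hpm.1, hC _]
      · simp [Function.uncurry, indicator_of_notMem hpm, hcd p.1 hp hpm p.2]
  simp_rw [← integral_const_mul]
  rw [integral_integral_swap hint]
  refine integral_congr_ae (.of_forall fun t => ?_)
  rcases le_or_gt t 0 with ht | ht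
  · simp [hq.eq_zero_of_nonpos ht]
  · dsimp only
    rw [← integral_dilation_mul_inv G ht, ← integral_mul_const]
    congr with a
    ring

section Pairing

variable {ξ w ζ v : ℝ → ℂ}

theorem CcTwo.integrable_fourier_dilation_mul (hξ : CcTwo ξ) (hw : CcTwo w) {a : ℝ} (ha : 0 ≤ a) :
    Integrable (𝓕 fun t => ξ (a * t) * w t) := by
  obtain ⟨C, -, hC⟩ := exists_norm_fourier_dilation_mul_le_inv hξ.1 hξ.2.1 hw.1 hw.2.1 a
  refine (integrable_inv_one_add_sq.const_mul C).mono' ?_ (.of_forall fun b => hC a b ha le_rfl)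
  exact ((stronglyMeasurable_fourier_dilation_mul hξ.continuous hw.continuous).comp_measurable
    (measurable_id.prodMk measurable_const)).aestronglyMeasurable

theorem CcTwo.integrable_fourier_mul_conj_fourier (hξ : CcTwo ξ) (hw : CcTwo w)
    (hζ : CcTwo ζ) (hv : CcTwo v) :
    Integrable (fun p : ℝ × ℝ => (p.2 : ℂ)⁻¹ * (𝓕 (fun t => ξ (p.2 * t) * w t) p.1 *
        conj (𝓕 (fun t => ζ (p.2 * t) * v t) p.1)))
      ((volume : Measure ℝ).prod (volume.restrict (Ioi 0))) := by
  obtain ⟨c, d, hc, hcd⟩ := hξ.exists_dilation_mul_eq_zero hw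
  obtain ⟨C, hC0, hC⟩ := exists_norm_fourier_dilation_mul_le_inv hξ.1 hξ.2.1 hw.1 hw.2.1 d
  obtain ⟨C', hC'⟩ :=
    exists_norm_fourier_dilation_mul_le hζ.continuous hζ.2.1 hv.continuous hv.2.1
  have hb : Integrable (fun a : ℝ => (Icc c d).indicator (fun _ => c⁻¹ * C') a)
      (volume.restrict (Ioi 0)) :=
    ((integrable_indicator_iff measurableSet_Icc).2 (integrableOn_const (by simp))).restrict
  refine ((integrable_inv_one_add_sq.const_mul C).mul_prod hb).mono' ?_ ?_
  · have m1 := (stronglyMeasurable_fourier_dilation_mul hξ.continuous hw.continuous).measurable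
    have m2 := (stronglyMeasurable_fourier_dilation_mul hζ.continuous hv.continuous).measurable
    have m3 := Complex.continuous_conj.measurable.comp m2
    exact (Measurable.mul (by fun_prop) (m1.mul m3)).aestronglyMeasurable
  · have : ∀ᵐ p ∂((volume : Measure ℝ).prod (volume.restrict (Ioi (0 : ℝ)))), p.2 ∈ Ioi (0 : ℝ) :=
      Measure.quasiMeasurePreserving_snd.ae (ae_restrict_mem measurableSet_Ioi)
    filter_upwards [this] with p hp
    have hp' : 0 < p.2 := hp
    by_cases hpm : p.2 ∈ Icc c d
    · rw [indicator_of_mem hpm, norm_mul, norm_mul, norm_inv, Complex.norm_real,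
        Real.norm_of_nonneg hp'.le, RCLike.norm_conj]
      calc p.2⁻¹ * (‖𝓕 (fun t => ξ (p.2 * t) * w t) p.1‖ *
            ‖𝓕 (fun t => ζ (p.2 * t) * v t) p.1‖)
          ≤ c⁻¹ * (C * (1 + p.1 ^ 2)⁻¹ * C') := by
            gcongr
            exacts [hpm.1, hC _ _ hp'.le hpm.2, hC' _ _]
        _ = C * (1 + p.1 ^ 2)⁻¹ * (c⁻¹ * C') := by ring
    · simp [indicator_of_notMem hpm, hcd p.2 hp hpm, Real.fourier_real_eq]

theorem CcTwo.integral_fourier_mul_conj_fourier_dilation (hξ : CcTwo ξ) (hw : CcTwo w)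
    (hζ : CcTwo ζ) (hv : CcTwo v) :
    ∫ p : ℝ × ℝ, (p.2 : ℂ)⁻¹ * (𝓕 (fun t => ξ (p.2 * t) * w t) p.1 *
        conj (𝓕 (fun t => ζ (p.2 * t) * v t) p.1))
      ∂((volume : Measure ℝ).prod (volume.restrict (Ioi 0))) =
    (∫ t in Ioi (0 : ℝ), ξ t * conj (ζ t) * (t : ℂ)⁻¹) * ∫ t, w t * conj (v t) := by
  rw [integral_prod_symm _ (hξ.integrable_fourier_mul_conj_fourier hw hζ hv),
    ← integral_integral_dilation_mul (hξ.mul_of_contDiffAt fun t _ => hζ.conj.1.contDiffAt)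
      (hw.mul_of_contDiffAt fun t _ => hv.conj.1.contDiffAt)]
  refine setIntegral_congr_fun measurableSet_Ioi fun a ha => ?_
  have hξc := hξ.continuous
  have hwc := hw.continuous
  dsimp only
  rw [integral_const_mul, integral_fourier_mul_conj_fourier (by fun_prop)
    (integrable_dilation_mul hξc hwc hw.2.1 a) (hξ.integrable_fourier_dilation_mul hw (le_of_lt ha))
    (integrable_dilation_mul hζ.continuous hv.continuous hv.2.1 a)]
  congr with t
  rw [map_mul]
  ring

end Pairing

theorem CcTwo.exists_pos_setIntegral_mul_conj_eq {ξ : ℝ → ℂ} (hξ : CcTwo ξ) (h0 : ξ ≠ 0) :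
    ∃ r : ℝ, 0 < r ∧ ∫ t in Ioi (0 : ℝ), ξ t * conj (ξ t) * (t : ℂ)⁻¹ = r := by
  obtain ⟨x, hx⟩ := Function.ne_iff.1 h0
  have hre : ∀ t : ℝ, ξ t * conj (ξ t) * (t : ℂ)⁻¹ = ((‖ξ t‖ ^ 2 * t⁻¹ : ℝ) : ℂ) := fun t => by
    rw [Complex.mul_conj']
    push_cast
    rfl
  have hG := (hξ.mul_of_contDiffAt fun t _ => hξ.conj.1.contDiffAt).mul_inv
  have hx0 : 0 < x := not_le.1 fun h => hx (hξ.eq_zero_of_nonpos h)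
  refine ⟨∫ t, ‖ξ t‖ ^ 2 * t⁻¹, ?_, ?_⟩
  · have hGre : (fun t : ℝ => ‖ξ t‖ ^ 2 * t⁻¹) =
        fun t => (ξ t * conj (ξ t) * (t : ℂ)⁻¹).re := by
      funext t; rw [hre, Complex.ofReal_re]
    refine Continuous.integral_pos_of_hasCompactSupport_nonneg_nonzero (x := x) ?_ ?_ ?_ ?_
    · rw [hGre]
      exact Complex.continuous_re.comp hG.continuous
    · rw [hGre]
      exact hG.2.1.comp_left (g := Complex.re) rfl
    · intro t
      rcases le_or_gt t 0 with ht | ht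
      · simp [hξ.eq_zero_of_nonpos ht]
      · simp only [Pi.zero_apply]; positivity
    · have : ξ x ≠ 0 := hx
      positivity
  · rw [setIntegral_eq_integral_of_forall_compl_eq_zero]
    · simp_rw [hre]
      exact integral_ofReal
    · intro t ht
      simp [hξ.eq_zero_of_nonpos (by simpa using ht)]

/-- Pairing of `-(2πi)⁻¹ a ∂_b (ξ₁ *₊ η₁)` against `conj(ξ₂ *₊ η₂)` in `L²(G)`
(the key computation in Proposition 4.8 of Choi–Ghandehari):
the value is `⟨ξ₁, ξ₂⟩_ℋ ⟨η₂, η₁⟩_ℋ`; in particular, taking all four functions equal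
to some `ξ₁ ≠ 0`, the value is strictly positive, so the cyclic derivation `D♭` is
not identically zero. -/
theorem pairing_deriv_plus_plus (ξ₁ η₁ ξ₂ η₂ : ℝ → ℂ)
    (hξ₁ : CcTwo ξ₁) (hη₁ : CcTwo η₁) (hξ₂ : CcTwo ξ₂) (hη₂ : CcTwo η₂) :
    Integrable (fun p : ℝ × ℝ =>
      (-(2 * (Real.pi : ℂ) * Complex.I)⁻¹ * (p.2 : ℂ)
          * deriv (fun b : ℝ => coeffP ξ₁ η₁ b p.2) p.1)
        * starRingEnd ℂ (coeffP ξ₂ η₂ p.1 p.2)) muG ∧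
    ∫ p, (-(2 * (Real.pi : ℂ) * Complex.I)⁻¹ * (p.2 : ℂ)
          * deriv (fun b : ℝ => coeffP ξ₁ η₁ b p.2) p.1)
        * starRingEnd ℂ (coeffP ξ₂ η₂ p.1 p.2) ∂muG
      = (∫ t in Ioi (0 : ℝ), ξ₁ t * starRingEnd ℂ (ξ₂ t) * (t : ℂ)⁻¹) *
        (∫ t in Ioi (0 : ℝ), η₂ t * starRingEnd ℂ (η₁ t) * (t : ℂ)⁻¹) ∧
    (ξ₂ = ξ₁ → η₁ = ξ₁ → η₂ = ξ₁ → ξ₁ ≠ 0 →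
      (0 < (∫ p, (-(2 * (Real.pi : ℂ) * Complex.I)⁻¹ * (p.2 : ℂ)
              * deriv (fun b : ℝ => coeffP ξ₁ η₁ b p.2) p.1)
            * starRingEnd ℂ (coeffP ξ₂ η₂ p.1 p.2) ∂muG).re ∧
       (∫ p, (-(2 * (Real.pi : ℂ) * Complex.I)⁻¹ * (p.2 : ℂ)
              * deriv (fun b : ℝ => coeffP ξ₁ η₁ b p.2) p.1)
            * starRingEnd ℂ (coeffP ξ₂ η₂ p.1 p.2) ∂muG).im = 0)) := by
  have hv₁ := hη₁.conj
  have hv₂ := hη₂.conj.mul_inv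
  have hmeas : Measurable fun p : ℝ × ℝ => ENNReal.ofReal ((p.2 ^ 2)⁻¹) := by fun_prop
  have hfin : ∀ᵐ p : ℝ × ℝ ∂((volume : Measure ℝ).prod (volume.restrict (Ioi (0 : ℝ)))),
      ENNReal.ofReal ((p.2 ^ 2)⁻¹) < ⊤ := .of_forall fun _ => ENNReal.ofReal_lt_top
  have hcongr : ∀ p : ℝ × ℝ, (ENNReal.ofReal ((p.2 ^ 2)⁻¹)).toReal •
      ((-(2 * (Real.pi : ℂ) * Complex.I)⁻¹ * (p.2 : ℂ)
          * deriv (fun b : ℝ => coeffP ξ₁ η₁ b p.2) p.1)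
        * starRingEnd ℂ (coeffP ξ₂ η₂ p.1 p.2)) =
      (p.2 : ℂ)⁻¹ * (𝓕 (fun t => ξ₁ (p.2 * t) * conj (η₁ t)) p.1 *
        conj (𝓕 (fun t => ξ₂ (p.2 * t) * (conj (η₂ t) * (t : ℂ)⁻¹)) p.1)) := fun p => by
    rw [mul_deriv_coeffP hξ₁ hη₁, coeffP_eq_fourier hη₂, ENNReal.toReal_ofReal (by positivity),
      Complex.real_smul]
    rcases eq_or_ne p.2 0 with h | h
    · simp [h]
    · have : (p.2 : ℂ) ≠ 0 := by simpa using h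
      push_cast
      field_simp
  have hI : ∫ p, (-(2 * (Real.pi : ℂ) * Complex.I)⁻¹ * (p.2 : ℂ)
          * deriv (fun b : ℝ => coeffP ξ₁ η₁ b p.2) p.1)
        * starRingEnd ℂ (coeffP ξ₂ η₂ p.1 p.2) ∂muG
      = (∫ t in Ioi (0 : ℝ), ξ₁ t * starRingEnd ℂ (ξ₂ t) * (t : ℂ)⁻¹) *
        (∫ t in Ioi (0 : ℝ), η₂ t * starRingEnd ℂ (η₁ t) * (t : ℂ)⁻¹) := by
    rw [muG, integral_withDensity_eq_integral_toReal_smul hmeas hfin]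
    simp_rw [hcongr]
    rw [hξ₁.integral_fourier_mul_conj_fourier_dilation hv₁ hξ₂ hv₂]
    congr 1
    rw [setIntegral_eq_integral_of_forall_compl_eq_zero fun t ht => by
      simp [hη₂.eq_zero_of_nonpos (not_lt.1 ht)]]
    congr with t
    simp only [map_mul, Complex.conj_conj, map_inv₀, Complex.conj_ofReal]
    ring
  refine ⟨?_, hI, ?_⟩
  · rw [muG, integrable_withDensity_iff_integrable_smul' hmeas hfin]
    simp_rw [hcongr]
    exact hξ₁.integrable_fourier_mul_conj_fourier hv₁ hξ₂ hv₂
  · rintro h₁ h₂ h₃ h0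
    rw [hI, h₁, h₂, h₃]
    obtain ⟨r, hr, hr'⟩ := hξ₁.exists_pos_setIntegral_mul_conj_eq h0
    rw [hr', ← Complex.ofReal_mul]
    exact ⟨by simpa using mul_pos hr hr, Complex.ofReal_im _⟩
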